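/- Let Ψ ∈ ℝ^{m×m} be symmetric positive definite and Φ ∈ ℝ^{m×m} symmetric positive semidefinite. Let λ₁ ≥ … ≥ λ_m ≥ 0 be the generalized eigenvalues of the pencil (Φ, Ψ) (i.e. the eigenvalues of Ψ⁻¹Φ), and assume λ_n > 0 and λ_n > λ_{n+1}. Suppose there exist Γ ∈ ℝ^{m×n} and the diagonal matrix Θ² = diag(λ₁,…,λ_n) with ΦΓ = ΨΓΘ² and Γᵀ S_p = I_n for a selector matrix S_p ∈ ℝ^{m×n}, and such that the columns of Γ span the sum of the generalized eigenspaces corresponding to λ₁,…,λ_n. Let (Q_T) and (M_T) be sequences of symmetric m×m matrices with Q_T − Φ = O(a_T) and M_T − Ψ = O(b_T) for positive reals a_T → 0, b_T → 0. Then for all sufficiently large T there exist matrices G_T ∈ ℝ^{m×n} and R_T² ∈ ℝ^{n×n} satisfying Q_T G_T = M_T G_T R_T², with G_T − Γ = O(a_T + b_T) and R_T² − Θ² = O(a_T + b_T). -/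

import Mathlib

open Filter Matrix Topology

/-- Frobenius norm of a real matrix. -/
noncomputable def frob {α β : Type*} [Fintype α] [Fintype β] (A : Matrix α β ℝ) : ℝ :=
  Real.sqrt (∑ i, ∑ j, (A i j) ^ 2)

/-- `F T = O(g T)` : the norm of `F T` divided by `g T` stays bounded. -/
def MBigO {α β : Type*} [Fintype α] [Fintype β] (F : ℕ → Matrix α β ℝ) (g : ℕ → ℝ) : Prop :=
  ∃ C : ℝ, ∀ᶠ T in atTop, frob (F T) ≤ C * g T

/-- A selector matrix: its columns are distinct columns of the identity matrix. -/
def IsSelector {p n : ℕ} (S : Matrix (Fin p) (Fin n) ℝ) : Prop :=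
  ∃ f : Fin n → Fin p, Function.Injective f ∧ ∀ i j, S i j = if i = f j then 1 else 0

/-- A sum of maximal generalized eigenspaces of `f` is closed under preimages of `f - θ`, for each
of the eigenvalues `θ` involved. -/
theorem mem_iSup_maxGenEigenspace_of_sub_smul_mem {K V ι : Type*} [Field K] [AddCommGroup V]
    [Module K V] [FiniteDimensional K V] (f : Module.End K V) (d : ι → K) (j : ι) {h : V}
    (hh : f h - d j • h ∈ ⨆ i, f.maxGenEigenspace (d i)) :
    h ∈ ⨆ i, f.maxGenEigenspace (d i) := by
  have key : ∀ v ∈ ⨆ i, f.maxGenEigenspace (d i), ∃ w ∈ ⨆ i, f.maxGenEigenspace (d i),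
      v - (f w - d j • w) ∈ f.maxGenEigenspace (d j) := by
    intro v hv
    refine Submodule.iSup_induction _ (motive := fun v => ∃ w ∈ ⨆ i, f.maxGenEigenspace (d i),
      v - (f w - d j • w) ∈ f.maxGenEigenspace (d j)) hv ?_ ?_ ?_
    · intro i x hx
      by_cases hij : d i = d j
      · exact ⟨0, zero_mem _, by simpa [← hij] using hx⟩
      have hmaps : ∀ y ∈ f.maxGenEigenspace (d i),
          (f - d j • (1 : Module.End K V)) y ∈ f.maxGenEigenspace (d i) :=
        Module.End.mapsTo_maxGenEigenspace_of_comm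
          ((Commute.refl f).sub_right ((Commute.one_right f).smul_right _)) (d i)
      have hinj : Function.Injective ((f - d j • (1 : Module.End K V)).restrict hmaps) := by
        rw [injective_iff_map_eq_zero]
        rintro ⟨y, hy⟩ h0
        have h1 : (f - d j • (1 : Module.End K V)) y = 0 := congrArg Subtype.val h0
        have h2 : y ∈ f.maxGenEigenspace (d j) :=
          (f.mem_maxGenEigenspace _ _).2 ⟨1, by simpa using h1⟩
        exact Subtype.ext
          (Submodule.disjoint_def.1 (f.disjoint_genEigenspace hij ⊤ ⊤) y hy h2)
      obtain ⟨⟨w, hw⟩, hwx⟩ := LinearMap.injective_iff_surjective.1 hinj ⟨x, hx⟩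
      have h1 : f w - d j • w = x := congrArg Subtype.val hwx
      exact ⟨w, Submodule.mem_iSup_of_mem i hw, by simp [h1]⟩
    · exact ⟨0, zero_mem _, by simp⟩
    · rintro x y ⟨w, hw, hwx⟩ ⟨z, hz, hzy⟩
      refine ⟨w + z, add_mem hw hz, ?_⟩
      convert add_mem hwx hzy using 1
      rw [map_add, smul_add]
      abel
  obtain ⟨w, hw, hwj⟩ := key _ hh
  obtain ⟨k, hk⟩ := (f.mem_maxGenEigenspace _ _).1 hwj
  have hd : h - w ∈ f.maxGenEigenspace (d j) := by
    refine (f.mem_maxGenEigenspace _ _).2 ⟨k + 1, ?_⟩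
    rw [pow_succ, Module.End.mul_apply, ← hk]
    congr 1
    simp only [LinearMap.sub_apply, LinearMap.smul_apply, Module.End.one_apply, map_sub]
  simpa using add_mem (Submodule.mem_iSup_of_mem (p := fun i => f.maxGenEigenspace (d i)) j hd) hw

/-- If the columns of `Γ` span the sum of the generalized eigenspaces of `A` for the eigenvalues
`d i`, then every solution `H` of `A H - H diag(d) = Γ K` factors through `Γ`. -/
theorem exists_eq_mul_of_sylvester {p q : Type*} [Fintype p] [DecidableEq p] [Fintype q]
    [DecidableEq q] {A : Matrix p p ℝ} {Γ H : Matrix p q ℝ} {K : Matrix q q ℝ} {d : q → ℝ}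
    (hspan : Submodule.span ℝ (Set.range Γᵀ) =
      ⨆ i, Module.End.maxGenEigenspace (Matrix.toLin' A) (d i))
    (h : A * H - H * Matrix.diagonal d = Γ * K) : ∃ Z : Matrix q q ℝ, H = Γ * Z := by
  have hmem : ∀ v : p → ℝ, v ∈ Submodule.span ℝ (Set.range Γᵀ) ↔ ∃ z, Γ *ᵥ z = v := by
    intro v
    have : Submodule.span ℝ (Set.range Γᵀ) = LinearMap.range Γ.mulVecLin :=
      (Matrix.range_mulVecLin Γ).symm
    rw [this, LinearMap.mem_range]
    rfl
  have hcol : ∀ j, ∃ z, Γ *ᵥ z = Hᵀ j := by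
    intro j
    rw [← hmem, hspan]
    refine mem_iSup_maxGenEigenspace_of_sub_smul_mem _ d j ?_
    rw [← hspan, hmem]
    refine ⟨Kᵀ j, ?_⟩
    ext i
    have := congrFun (congrFun h i) j
    simp only [Matrix.sub_apply, Matrix.mul_diagonal] at this
    simp only [Matrix.toLin'_apply, Pi.sub_apply, Pi.smul_apply, smul_eq_mul,
      Matrix.transpose_apply]
    rw [mul_comm (d j)]
    exact this.symm
  choose z hz using hcol
  refine ⟨(Matrix.of z)ᵀ, ?_⟩
  ext i j
  exact (congrFun (hz j) i).symm

/-- Sequences converging to `f x` lift through a map with invertible strict derivative at `x`, with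
the same rate of convergence. -/
theorem HasStrictFDerivAt.exists_eventually_eq_isBigO {ι E F : Type*} [NormedAddCommGroup E]
    [NormedSpace ℝ E] [CompleteSpace E] [NormedAddCommGroup F] [NormedSpace ℝ F] {f : E → F}
    {f' : E ≃L[ℝ] F} {x : E} (hf : HasStrictFDerivAt f (f' : E →L[ℝ] F) x) {l : Filter ι}
    {u : ι → F} (hu : Tendsto u l (𝓝 (f x))) :
    ∃ v : ι → E, (∀ᶠ t in l, f (v t) = u t) ∧
      (fun t => v t - x) =O[l] (fun t => u t - f x) := by
  refine ⟨fun t => hf.localInverse f f' x (u t), hu.eventually hf.eventually_right_inverse, ?_⟩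
  have := hf.to_localInverse.hasFDerivAt.isBigO_sub.comp_tendsto hu
  simpa [Function.comp_def] using this

section Frobenius

attribute [local instance] Matrix.frobeniusNormedAddCommGroup Matrix.frobeniusNormedSpace

theorem frob_eq_norm {α β : Type*} [Fintype α] [Fintype β] (A : Matrix α β ℝ) :
    frob A = ‖A‖ := by
  rw [Matrix.frobenius_norm_def, frob, Real.sqrt_eq_rpow]
  simp

theorem mbigO_iff_isBigO {α β : Type*} [Fintype α] [Fintype β] {F : ℕ → Matrix α β ℝ}
    {g : ℕ → ℝ} (hg : ∀ T, 0 < g T) : MBigO F g ↔ F =O[atTop] g := by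
  simp only [MBigO, Asymptotics.isBigO_iff, frob_eq_norm, Real.norm_of_nonneg (hg _).le]

theorem Matrix.isBoundedBilinearMap_mul {α β γ : Type*} [Fintype α] [Fintype β] [Fintype γ] :
    IsBoundedBilinearMap ℝ (fun p : Matrix α β ℝ × Matrix β γ ℝ => p.1 * p.2) where
  add_left _ _ _ := Matrix.add_mul _ _ _
  smul_left _ _ _ := Matrix.smul_mul _ _ _
  add_right _ _ _ := Matrix.mul_add _ _ _
  smul_right _ _ _ := Matrix.mul_smul _ _ _
  bound := ⟨1, one_pos, fun A B => by simpa using Matrix.frobenius_norm_mul A B⟩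

theorem HasStrictFDerivAt.matrix_mul {E α β γ : Type*} [NormedAddCommGroup E] [NormedSpace ℝ E]
    [Fintype α] [Fintype β] [Fintype γ] {f : E → Matrix α β ℝ} {g : E → Matrix β γ ℝ}
    {f' : E →L[ℝ] Matrix α β ℝ} {g' : E →L[ℝ] Matrix β γ ℝ} {x : E}
    (hf : HasStrictFDerivAt f f' x) (hg : HasStrictFDerivAt g g' x) :
    HasStrictFDerivAt (fun y => f y * g y)
      ((Matrix.isBoundedBilinearMap_mul.deriv (f x, g x)).comp (f'.prod g')) x :=
  (Matrix.isBoundedBilinearMap_mul.hasStrictFDerivAt (f x, g x)).comp x (hf.prodMk hg)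

/-- The map `(Q, M, G, R) ↦ (Q, M, Q G - M G R, S G)`, whose local inverse solves the generalized
eigenvalue problem for `(Q, M)` under the normalization prescribing `S G`. -/
def pencilMap {p q : Type*} [Fintype p] [Fintype q] (S : Matrix q p ℝ)
    (x : Matrix p p ℝ × Matrix p p ℝ × Matrix p q ℝ × Matrix q q ℝ) :
    Matrix p p ℝ × Matrix p p ℝ × Matrix p q ℝ × Matrix q q ℝ :=
  (x.1, x.2.1, x.1 * x.2.2.1 - x.2.1 * (x.2.2.1 * x.2.2.2), S * x.2.2.1)

theorem exists_hasStrictFDerivAt_pencilMap {p q : Type*} [Fintype p] [Fintype q]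
    (S : Matrix q p ℝ) (Q M : Matrix p p ℝ) (G : Matrix p q ℝ) (R : Matrix q q ℝ)
    (hinj : ∀ (H : Matrix p q ℝ) (K : Matrix q q ℝ),
      Q * H - M * (G * K + H * R) = 0 → S * H = 0 → H = 0 ∧ K = 0) :
    ∃ f' : (Matrix p p ℝ × Matrix p p ℝ × Matrix p q ℝ × Matrix q q ℝ) ≃L[ℝ]
        (Matrix p p ℝ × Matrix p p ℝ × Matrix p q ℝ × Matrix q q ℝ),
      HasStrictFDerivAt (pencilMap S) (f' : _ →L[ℝ] _) (Q, M, G, R) := by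
  have h1 := hasStrictFDerivAt_fst (𝕜 := ℝ)
    (p := ((Q, M, G, R) : Matrix p p ℝ × Matrix p p ℝ × Matrix p q ℝ × Matrix q q ℝ))
  have h2 := hasStrictFDerivAt_snd (𝕜 := ℝ)
    (p := ((Q, M, G, R) : Matrix p p ℝ × Matrix p p ℝ × Matrix p q ℝ × Matrix q q ℝ))
  have hM := h2.fst
  have hG := h2.snd.fst
  have hR := h2.snd.snd
  obtain ⟨D, hD, hDapply⟩ : ∃ D : (Matrix p p ℝ × Matrix p p ℝ × Matrix p q ℝ × Matrix q q ℝ) →L[ℝ]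
      (Matrix p p ℝ × Matrix p p ℝ × Matrix p q ℝ × Matrix q q ℝ),
      HasStrictFDerivAt (pencilMap S) D (Q, M, G, R) ∧ ∀ A B H K, D (A, B, H, K) =
        (A, B, Q * H + A * G - (M * (G * K + H * R) + B * (G * R)),
          S * H + (0 : Matrix q p ℝ) * G) :=
    ⟨_, h1.prodMk (hM.prodMk (((h1.matrix_mul hG).sub
      (hM.matrix_mul (hG.matrix_mul hR))).prodMk ((hasStrictFDerivAt_const S _).matrix_mul hG))),
      fun A B H K => rfl⟩
  have hDinj : Function.Injective D.toLinearMap := by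
    refine (injective_iff_map_eq_zero D.toLinearMap).2 ?_
    rintro ⟨A, B, H, K⟩ h0
    have h0' := (hDapply A B H K).symm.trans h0
    simp only [Prod.mk_eq_zero] at h0'
    obtain ⟨rfl, rfl, h3, h4⟩ := h0'
    simp only [Matrix.zero_mul, add_zero] at h3 h4
    obtain ⟨rfl, rfl⟩ := hinj H K h3 h4
    rfl
  exact ⟨(LinearEquiv.ofInjectiveEndo _ hDinj).toContinuousLinearEquiv, hD⟩

/-- Lemma 5(I) of the paper.  The perturbed generalized eigenvalue
problem `Q_T G_T = M_T G_T R_T²` admits solutions converging to the solution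
`(Γ, Θ²)` of the limiting problem `Φ Γ = Ψ Γ Θ²` at the rate `a_T + b_T` of the
perturbations, where `μ` enumerates the generalized eigenvalues of the pencil
`(Φ, Ψ)` in decreasing order (here 0-indexed: `μ i = λ_{i+1}`), `λ_n > 0`,
`λ_n > λ_{n+1}`, `Θ² = diag(λ₁,…,λ_n)`, `Γᵀ S_p = I` for a selector matrix, and
the columns of `Γ` span the sum of the generalized eigenspaces of `Ψ⁻¹Φ`
corresponding to `λ₁,…,λ_n`. -/
theorem stmt4 (m n : ℕ) (hn0 : 0 < n) (hnm : n < m)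
    (Ψ Φ : Matrix (Fin m) (Fin m) ℝ) (hΨ : Ψ.PosDef) (hΦ : Φ.PosSemidef)
    (μ : Fin m → ℝ) (hμmono : Antitone μ) (hμnonneg : ∀ i, 0 ≤ μ i)
    (hμeig : (Ψ⁻¹ * Φ).charpoly = ∏ i : Fin m, (Polynomial.X - Polynomial.C (μ i)))
    (hlam_n : 0 < μ ⟨n - 1, by omega⟩)
    (hgap : μ ⟨n, hnm⟩ < μ ⟨n - 1, by omega⟩)
    (Γ : Matrix (Fin m) (Fin n) ℝ)
    (Θ2 : Matrix (Fin n) (Fin n) ℝ)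
    (hΘ2 : Θ2 = Matrix.diagonal (fun i : Fin n => μ (Fin.castLE hnm.le i)))
    (hΓeig : Φ * Γ = Ψ * Γ * Θ2)
    (Sp : Matrix (Fin m) (Fin n) ℝ) (hSp : IsSelector Sp) (hΓSp : Γᵀ * Sp = 1)
    (hspan : Submodule.span ℝ (Set.range Γᵀ) =
      ⨆ i : Fin n,
        Module.End.maxGenEigenspace (Matrix.toLin' (Ψ⁻¹ * Φ)) (μ (Fin.castLE hnm.le i)))
    (Q M : ℕ → Matrix (Fin m) (Fin m) ℝ)
    (hQsym : ∀ T, (Q T)ᵀ = Q T) (hMsym : ∀ T, (M T)ᵀ = M T)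
    (a b : ℕ → ℝ) (hapos : ∀ T, 0 < a T) (hbpos : ∀ T, 0 < b T)
    (ha : Tendsto a atTop (𝓝 0)) (hb : Tendsto b atTop (𝓝 0))
    (hQ : MBigO (fun T => Q T - Φ) a) (hM : MBigO (fun T => M T - Ψ) b) :
    ∃ (G : ℕ → Matrix (Fin m) (Fin n) ℝ) (R2 : ℕ → Matrix (Fin n) (Fin n) ℝ),
      (∀ᶠ T in atTop, Q T * G T = M T * G T * R2 T) ∧
      MBigO (fun T => G T - Γ) (fun T => a T + b T) ∧
      MBigO (fun T => R2 T - Θ2) (fun T => a T + b T) := by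
  have hSΓ : Spᵀ * Γ = 1 := by simpa using congrArg Matrix.transpose hΓSp
  have hdet : IsUnit Ψ.det := hΨ.det_pos.ne'.isUnit
  have hinj : ∀ (H : Matrix (Fin m) (Fin n) ℝ) (K : Matrix (Fin n) (Fin n) ℝ),
      Φ * H - Ψ * (Γ * K + H * Θ2) = 0 → Spᵀ * H = 0 → H = 0 ∧ K = 0 := by
    intro H K h hS
    have hsylv : Ψ⁻¹ * Φ * H - H * Θ2 = Γ * K := by
      have h' := congrArg (Ψ⁻¹ * ·) h
      simp only [Matrix.mul_sub, Matrix.nonsing_inv_mul_cancel_left _ _ hdet, Matrix.mul_zero,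
        ← Matrix.mul_assoc Ψ⁻¹ Φ] at h'
      rw [sub_eq_zero.1 h', add_sub_cancel_right]
    rw [hΘ2] at hsylv
    obtain ⟨Z, rfl⟩ := exists_eq_mul_of_sylvester hspan hsylv
    have hZ : Z = 0 := by rwa [← Matrix.mul_assoc, hSΓ, Matrix.one_mul] at hS
    subst hZ
    have hK := congrArg (Spᵀ * ·) hsylv
    simp only [Matrix.mul_zero, Matrix.zero_mul, sub_zero, ← Matrix.mul_assoc, hSΓ,
      Matrix.one_mul] at hK
    exact ⟨Matrix.mul_zero _, hK.symm⟩
  obtain ⟨f', hf⟩ := exists_hasStrictFDerivAt_pencilMap Spᵀ Φ Ψ Γ Θ2 hinj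
  have hab : ∀ T, 0 < a T + b T := fun T => add_pos (hapos T) (hbpos T)
  rw [mbigO_iff_isBigO hapos] at hQ
  rw [mbigO_iff_isBigO hbpos] at hM
  have hbase : pencilMap Spᵀ (Φ, Ψ, Γ, Θ2) = (Φ, Ψ, 0, 1) := by
    simp [pencilMap, hSΓ, hΓeig, Matrix.mul_assoc]
  have hQ' : (fun T => Q T - Φ) =O[atTop] (fun T => a T + b T) :=
    hQ.trans (.of_norm_le fun T => by
      rw [Real.norm_of_nonneg (hapos T).le]; linarith [hbpos T])
  have hM' : (fun T => M T - Ψ) =O[atTop] (fun T => a T + b T) :=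
    hM.trans (.of_norm_le fun T => by
      rw [Real.norm_of_nonneg (hbpos T).le]; linarith [hapos T])
  have hQt : Tendsto Q atTop (𝓝 Φ) := tendsto_sub_nhds_zero_iff.1 (hQ.trans_tendsto ha)
  have hMt : Tendsto M atTop (𝓝 Ψ) := tendsto_sub_nhds_zero_iff.1 (hM.trans_tendsto hb)
  obtain ⟨v, hv, hvO⟩ := hf.exists_eventually_eq_isBigO (l := atTop)
    (u := fun T => (Q T, M T, (0 : Matrix (Fin m) (Fin n) ℝ), (1 : Matrix (Fin n) (Fin n) ℝ)))
    (hbase ▸ hQt.prodMk_nhds (hMt.prodMk_nhds (tendsto_const_nhds.prodMk_nhds tendsto_const_nhds)))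
  have hvO' : (fun T => v T - (Φ, Ψ, Γ, Θ2)) =O[atTop] (fun T => a T + b T) := by
    refine hvO.trans ?_
    rw [hbase]
    simp only [Prod.mk_sub_mk, sub_self]
    exact hQ'.prod_left (hM'.prod_left
      ((Asymptotics.isBigO_zero _ _).prod_left (Asymptotics.isBigO_zero _ _)))
  refine ⟨fun T => (v T).2.2.1, fun T => (v T).2.2.2, ?_, ?_, ?_⟩
  · filter_upwards [hv] with T hT
    simp only [pencilMap, Prod.mk.injEq] at hT
    obtain ⟨h1, h2, h3, -⟩ := hT
    rw [h1, h2, sub_eq_zero] at h3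
    rw [h3, Matrix.mul_assoc]
  · exact (mbigO_iff_isBigO hab).2 hvO'.prod_left_snd.prod_left_snd.prod_left_fst
  · exact (mbigO_iff_isBigO hab).2 hvO'.prod_left_snd.prod_left_snd.prod_left_snd

end Frobenius
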